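/- Let u : ℝ → ℝ be five times continuously differentiable in a neighborhood of 0 with u'(0) ≠ 0 and u'''(0) ≠ 0. For Δx > 0 define the adaptive shape parameter s(Δx) = −u'''(Δx/2)/(3·u'(Δx/2)). Then there exist C > 0 and Δx₀ > 0 such that for all 0 < Δx < Δx₀ and every triple λ₁, λ₂, λ₃ ∈ ℝ satisfying the interpolation conditions Σ_{j=0}^{2} λ_{j+1}·√(1 + s(Δx)·(x_k − x_j)²) = u(x_k) for k = 0, 1, 2 with nodes x_j = j·Δx, the MQ interpolant I(x) = Σ_{j=0}^{2} λ_{j+1}·√(1 + s(Δx)·(x − x_j)²) satisfies |u(Δx/2) − I(Δx/2)| ≤ C·Δx⁴; i.e., the adaptation condition 3ε²u' + u''' = 0 raises the three-point interpolation error at x = Δx/2 from the polynomial order O(Δx³) to O(Δx⁴). -/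

import Mathlib

theorem sqrt_one_add_eq_cubic_remainder {x : ℝ} (hx : -1 ≤ x) :
    ∃ r : ℝ, |r| ≤ 3 / 8 ∧ Real.sqrt (1 + x) = 1 + x / 2 - x ^ 2 / 8 + x ^ 3 * r := by
  have hy : 0 ≤ Real.sqrt (1 + x) := Real.sqrt_nonneg _
  have hyx : x = Real.sqrt (1 + x) ^ 2 - 1 := by
    rw [Real.sq_sqrt (by linarith)]; ring
  generalize Real.sqrt (1 + x) = y at hy hyx
  subst hyx
  refine ⟨(3 + y) / (8 * (1 + y) ^ 3), ?_, ?_⟩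
  · rw [abs_of_nonneg (by positivity), div_le_iff₀ (by positivity)]
    nlinarith [pow_nonneg hy 2, pow_nonneg hy 3]
  · field_simp
    ring

theorem abs_mul_le_mul {x y X Y : ℝ} (hx : |x| ≤ X) (hy : |y| ≤ Y) : |x * y| ≤ X * Y := by
  rw [abs_mul]
  exact mul_le_mul hx hy (abs_nonneg _) ((abs_nonneg _).trans hx)

theorem abs_add_le_add {x y X Y : ℝ} (hx : |x| ≤ X) (hy : |y| ≤ Y) : |x + y| ≤ X + Y :=
  (abs_add_le x y).trans (add_le_add hx hy)

theorem abs_sub_le_add {x y X Y : ℝ} (hx : |x| ≤ X) (hy : |y| ≤ Y) : |x - y| ≤ X + Y :=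
  (abs_sub x y).trans (add_le_add hx hy)

theorem abs_div_le_of_one_le {x y X : ℝ} (hx : |x| ≤ X) (hy : 1 ≤ |y|) : |x / y| ≤ X := by
  rw [abs_div]
  exact (div_le_self (abs_nonneg _) hy).trans hx

/-- The multiquadric interpolation weights at the half node are
`(p + q) / 2, w, (p - q) / 2` with `p = 1/4 + O(σ)`, `2 q = 1 + 3σ/8 + O(σ²)` and
`p + w = 1 + O(σ²)`, where `σ` is the shape parameter times the squared step. -/
theorem exists_multiquadric_weights {σ : ℝ} (hσ : |σ| ≤ 1 / 100) :
    ∃ p' q' m : ℝ, |p'| ≤ 100 ∧ |q'| ≤ 100 ∧ |m| ≤ 100 ∧ ∀ u₀ u₁ u₂ l₁ l₂ l₃ : ℝ,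
      l₁ + l₂ * Real.sqrt (1 + σ) + l₃ * Real.sqrt (1 + 4 * σ) = u₀ →
      l₁ * Real.sqrt (1 + σ) + l₂ + l₃ * Real.sqrt (1 + σ) = u₁ →
      l₁ * Real.sqrt (1 + 4 * σ) + l₂ * Real.sqrt (1 + σ) + l₃ = u₂ →
      l₁ * Real.sqrt (1 + σ / 4) + l₂ * Real.sqrt (1 + σ / 4) + l₃ * Real.sqrt (1 + 9 * σ / 4)
        = (1 / 4 + σ * p') * ((u₀ + u₂) / 2)
          + (1 + 3 * σ / 8 + σ ^ 2 * q') / 2 * ((u₀ - u₂) / 2)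
          + (3 / 4 + σ ^ 2 * m - σ * p') * u₁ := by
  have hs := abs_le.1 hσ
  obtain ⟨α, hα, ha⟩ := sqrt_one_add_eq_cubic_remainder (x := σ / 4) (by linarith)
  obtain ⟨ε, hε, he⟩ := sqrt_one_add_eq_cubic_remainder (x := σ) (by linarith)
  obtain ⟨β, hβ, hb⟩ := sqrt_one_add_eq_cubic_remainder (x := 9 * σ / 4) (by linarith)
  obtain ⟨φ, hφ, hf⟩ := sqrt_one_add_eq_cubic_remainder (x := 4 * σ) (by linarith)
  have hee : Real.sqrt (1 + σ) ^ 2 = 1 + σ := Real.sq_sqrt (by linarith)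
  have he0 : 0 ≤ Real.sqrt (1 + σ) := Real.sqrt_nonneg _
  generalize Real.sqrt (1 + σ / 4) = a at *
  generalize Real.sqrt (1 + 9 * σ / 4) = b at *
  generalize Real.sqrt (1 + 4 * σ) = f at *
  generalize Real.sqrt (1 + σ) = e at *
  have hα' := abs_le.1 hα
  have hβ' := abs_le.1 hβ
  have hφ' := abs_le.1 hφ
  have hσφ := abs_le.1 (abs_mul_le_mul hσ hφ)
  have hσ2φ := abs_le.1 (abs_mul_le_mul hσ (abs_mul_le_mul hσ hφ))
  have hσα := abs_le.1 (abs_mul_le_mul hσ hα)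
  have hσε := abs_le.1 (abs_mul_le_mul hσ hε)
  have hσ2ε := abs_le.1 (abs_mul_le_mul hσ (abs_mul_le_mul hσ hε))
  have he2 : |e| ≤ 2 := by rw [abs_of_nonneg he0]; nlinarith
  have hā : |1 + σ / 8 - σ ^ 2 / 128| ≤ 2 := by
    rw [abs_le]; constructor <;> nlinarith
  have hεā := abs_le.1 (abs_mul_le_mul hε hā)
  have hαe := abs_le.1 (abs_mul_le_mul hα he2)
  have hD : 1 ≤ |-2 + 64 * (σ * φ)| := by
    rw [le_abs]; right; linarith
  have hE : 1 ≤ |2 - 2 * σ + 64 * (σ * (σ * φ))| := by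
    rw [le_abs]; left; linarith
  have hD0 : -2 + 64 * (σ * φ) ≠ 0 := fun h => by norm_num [h] at hD
  have hE0 : 2 - 2 * σ + 64 * (σ * (σ * φ)) ≠ 0 := fun h => by norm_num [h] at hE
  obtain ⟨p', hp', hpD⟩ : ∃ p' : ℝ, |p'| ≤ 20 ∧ p' * (-2 + 64 * (σ * φ)) =
      α / 64 + 729 / 64 * β + 5 / 128 - σ / 512 - 2 * (ε * (1 + σ / 8 - σ ^ 2 / 128))
        - (α * e) / 32 - 16 * φ :=
    ⟨_, abs_div_le_of_one_le (abs_le.2 ⟨by linarith, by linarith⟩) hD, div_mul_cancel₀ _ hD0⟩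
  obtain ⟨q', hq', hqE⟩ : ∃ q' : ℝ, |q'| ≤ 100 ∧ q' * (2 - 2 * σ + 64 * (σ * (σ * φ))) =
      2 * (729 / 64 * β - α / 64) - 64 * φ + 3 / 4 - 24 * (σ * φ) :=
    ⟨_, abs_div_le_of_one_le (abs_le.2 ⟨by linarith, by linarith⟩) hE, div_mul_cancel₀ _ hE0⟩
  have hg : |-1 / 2 + σ / 8 - σ * (σ * ε)| ≤ 1 := abs_le.2 ⟨by linarith, by linarith⟩
  have hpg := abs_le.1 (abs_mul_le_mul hp' hg)
  refine ⟨p', q', 3 / 128 - (σ * ε) / 4 + p' * (-1 / 2 + σ / 8 - σ * (σ * ε)) + (σ * α) / 64,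
    hp'.trans (by norm_num), hq', abs_le.2 ⟨by linarith, by linarith⟩, ?_⟩
  rintro _ _ _ l₁ l₂ l₃ rfl rfl rfl
  have hq : (1 + 3 * σ / 8 + σ ^ 2 * q') / 2 * (1 - f) = a - b := by
    rw [ha, hb, hf]
    linear_combination (-σ ^ 3 / 2) * hqE
  have hp : (1 / 4 + σ * p') * (f - 1 - 2 * σ) = a + b - 2 * (e * a) := by
    rw [ha, hb, hf]
    linear_combination σ ^ 3 * hpD + 2 * (1 + σ / 8 - σ ^ 2 / 128) * he
  have hw : (1 / 4 + σ * p') * e + (3 / 4 + σ ^ 2 * (3 / 128 - (σ * ε) / 4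
      + p' * (-1 / 2 + σ / 8 - σ * (σ * ε)) + (σ * α) / 64) - σ * p') = a := by
    rw [ha, he]
    ring
  generalize 3 / 4 + σ ^ 2 * (3 / 128 - (σ * ε) / 4
      + p' * (-1 / 2 + σ / 8 - σ * (σ * ε)) + (σ * α) / 64) - σ * p' = w at *
  linear_combination (-(l₁ - l₃) / 2) * hq - (l₁ + l₃) / 2 * hp - ((l₁ + l₃) * e + l₂) * hw
    + (l₁ + l₃) * (1 / 4 + σ * p') * hee

theorem ContDiffAt.exists_taylor_remainder_right {f : ℝ → ℝ} {n : ℕ}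
    (hf : ContDiffAt ℝ (n + 1) f 0) :
    ∃ C > 0, ∃ r > 0, ∀ x ∈ Set.Icc (0 : ℝ) r,
      |f x - ∑ k ∈ Finset.range (n + 1), iteratedDeriv k f 0 / k.factorial * x ^ k|
        ≤ C * x ^ (n + 1) := by
  obtain ⟨s, hs, hfs⟩ := hf.contDiffOn (m := n + 1) le_rfl (by simp)
  obtain ⟨r, hr, hrs⟩ := Metric.nhds_basis_closedBall.mem_iff.1 hs
  have hI : Set.Icc (0 : ℝ) r ⊆ s := fun x hx => hrs <| by
    rw [Metric.mem_closedBall, Real.dist_0_eq_abs, abs_of_nonneg hx.1]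
    exact hx.2
  obtain ⟨C, hC⟩ := exists_taylor_mean_remainder_bound hr.le (hfs.mono hI)
  refine ⟨max C 1, by positivity, r, hr, fun x hx => ?_⟩
  have h := hC x hx
  rw [taylor_within_apply, Real.norm_eq_abs, sub_zero] at h
  have hsum : ∑ k ∈ Finset.range (n + 1), iteratedDeriv k f 0 / k.factorial * x ^ k =
      ∑ k ∈ Finset.range (n + 1), ((k.factorial : ℝ)⁻¹ * x ^ k) •
        iteratedDerivWithin k f (Set.Icc 0 r) 0 := by
    refine Finset.sum_congr rfl fun k hk => ?_
    rw [iteratedDerivWithin_eq_iteratedDeriv (uniqueDiffOn_Icc hr)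
      (hf.of_le (by exact_mod_cast (Finset.mem_range.1 hk).le)) (Set.left_mem_Icc.2 hr.le),
      smul_eq_mul]
    ring
  rw [hsum]
  exact h.trans (mul_le_mul_of_nonneg_right (le_max_left _ _) (pow_nonneg hx.1 _))


/-- A perturbed cubic with coefficients `c₀, c₁, c₂, c₃` is reproduced by the multiquadric weights
up to fourth order when the adaptation condition `3 s v₁ + v₃ = 0` holds. -/
theorem abs_sub_weighted_sum_le {c₀ c₁ c₂ c₃ S M M₁ M₃ d s U u₁ u₂ v₁ v₃ p' q' m : ℝ}
    (hd : 0 < d) (hd1 : d ≤ 1) (hs : |s| ≤ S) (hσ : |s * d ^ 2| ≤ 1 / 100)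
    (hU : |U - (c₀ + c₁ * (d / 2) + c₂ * (d / 2) ^ 2 + c₃ * (d / 2) ^ 3)| ≤ M * d ^ 4)
    (hu₁ : |u₁ - (c₀ + c₁ * d + c₂ * d ^ 2 + c₃ * d ^ 3)| ≤ M * d ^ 4)
    (hu₂ : |u₂ - (c₀ + c₁ * (2 * d) + c₂ * (2 * d) ^ 2 + c₃ * (2 * d) ^ 3)| ≤ M * d ^ 4)
    (hv₁ : |v₁ - c₁| ≤ M₁ * d) (hv₃ : |v₃ - 6 * c₃| ≤ M₃ * d) (hv : 3 * s * v₁ + v₃ = 0)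
    (hp' : |p'| ≤ 100) (hq' : |q'| ≤ 100) (hm : |m| ≤ 100) :
    |U - ((1 / 4 + s * d ^ 2 * p') * ((c₀ + u₂) / 2)
          + (1 + 3 * (s * d ^ 2) / 8 + (s * d ^ 2) ^ 2 * q') / 2 * ((c₀ - u₂) / 2)
          + (3 / 4 + (s * d ^ 2) ^ 2 * m - s * d ^ 2 * p') * u₁)|
      ≤ (|c₀| * (S * (S * 100)) + |c₁| * (S * (S * 150)) + |c₂| * (S * 103) + |c₃| * (S * 304)
          + 10 * M + (3 * (S * M₁) + M₃) / 16) * d ^ 4 := by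
  have hd4 : |d ^ 4| ≤ d ^ 4 := (abs_of_pos (by positivity)).le
  have hd3 : |d ^ 3 / 16| ≤ d ^ 3 / 16 := (abs_of_pos (by positivity)).le
  have hda : |d| ≤ 1 := by rwa [abs_of_pos hd]
  have h₀ : |c₀ * (s * (s * m))| ≤ |c₀| * (S * (S * 100)) :=
    abs_mul_le_mul le_rfl (abs_mul_le_mul hs (abs_mul_le_mul hs hm))
  have hp := abs_le.1 hp'
  have hq := abs_le.1 hq'
  have hmm := abs_le.1 hm
  have hσ' := abs_le.1 hσ
  have hσp := abs_le.1 (abs_mul_le_mul hσ hp')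
  have hσq := abs_le.1 (abs_mul_le_mul hσ hq')
  have hσm := abs_le.1 (abs_mul_le_mul hσ hm)
  have hσσq := abs_le.1 (abs_mul_le_mul hσ (abs_mul_le_mul hσ hq'))
  have hσσm := abs_le.1 (abs_mul_le_mul hσ (abs_mul_le_mul hσ hm))
  have h₁ : |c₁ * (s * (s * (d * (q' / 2 - m))))| ≤ |c₁| * (S * (S * 150)) := by
    refine abs_mul_le_mul le_rfl (abs_mul_le_mul hs (abs_mul_le_mul hs ?_))
    exact (abs_mul_le_mul hda (Y := 150) (abs_le.2 ⟨by linarith, by linarith⟩)).trans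
      (by norm_num)
  have h₂ : |c₂ * (s * (-p' + 3 / 8 + s * d ^ 2 * q' - s * d ^ 2 * m))| ≤ |c₂| * (S * 103) :=
    abs_mul_le_mul le_rfl (abs_mul_le_mul hs (abs_le.2 ⟨by linarith, by linarith⟩))
  have h₃ : |c₃ * (s * (d * (-3 * p' + 3 / 4 + 2 * (s * d ^ 2 * q') - s * d ^ 2 * m)))|
      ≤ |c₃| * (S * 304) := by
    refine abs_mul_le_mul le_rfl (abs_mul_le_mul hs ?_)
    exact (abs_mul_le_mul hda (Y := 304) (abs_le.2 ⟨by linarith, by linarith⟩)).trans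
      (by norm_num)
  have hw₂ : |(1 / 4 + s * d ^ 2 * p') / 2
      - (1 + 3 * (s * d ^ 2) / 8 + s * d ^ 2 * (s * d ^ 2 * q')) / 4| ≤ 4 :=
    abs_le.2 ⟨by linarith, by linarith⟩
  have hw₁ : |3 / 4 + s * d ^ 2 * (s * d ^ 2 * m) - s * d ^ 2 * p'| ≤ 5 :=
    abs_le.2 ⟨by linarith, by linarith⟩
  have hadapt := abs_mul_le_mul hd3 (abs_add_le_add
    (abs_mul_le_mul (x := 3) (X := 3) (by norm_num) (abs_mul_le_mul hs hv₁)) hv₃)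
  have hpoly := abs_mul_le_mul hd4
    (abs_add_le_add (abs_add_le_add (abs_sub_le_add h₁ h₀) h₂) h₃)
  have key := abs_sub_le_add (abs_sub_le_add (abs_add_le_add (abs_sub_le_add hpoly hadapt) hU)
    (abs_mul_le_mul hw₂ hu₂)) (abs_mul_le_mul hw₁ hu₁)
  refine (le_of_eq (congrArg _ ?_)).trans (key.trans (le_of_eq ?_))
  · linear_combination (d ^ 3 / 16) * hv
  · ring


/-- The adaptation condition `3ε²u' + u''' = 0` at the evaluation point raises
the three-point MQ interpolation error at `x = Δx/2` from `O(Δx³)` to `O(Δx⁴)`. -/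
theorem stmt_16 (u : ℝ → ℝ) (hu : ContDiffAt ℝ 5 u 0)
    (hu1 : deriv u 0 ≠ 0) (hu3 : iteratedDeriv 3 u 0 ≠ 0) :
    ∃ C > 0, ∃ d₀ > 0, ∀ d : ℝ, 0 < d → d < d₀ →
      ∀ l1 l2 l3 : ℝ,
        (∀ k : Fin 3,
          l1 * Real.sqrt (1 + -iteratedDeriv 3 u (d / 2) / (3 * deriv u (d / 2))
                * ((k : ℝ) * d - 0 * d) ^ 2)
            + l2 * Real.sqrt (1 + -iteratedDeriv 3 u (d / 2) / (3 * deriv u (d / 2))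
                * ((k : ℝ) * d - 1 * d) ^ 2)
            + l3 * Real.sqrt (1 + -iteratedDeriv 3 u (d / 2) / (3 * deriv u (d / 2))
                * ((k : ℝ) * d - 2 * d) ^ 2)
            = u ((k : ℝ) * d)) →
        |u (d / 2)
            - (l1 * Real.sqrt (1 + -iteratedDeriv 3 u (d / 2) / (3 * deriv u (d / 2))
                  * (d / 2 - 0 * d) ^ 2)
              + l2 * Real.sqrt (1 + -iteratedDeriv 3 u (d / 2) / (3 * deriv u (d / 2))
                  * (d / 2 - 1 * d) ^ 2)
              + l3 * Real.sqrt (1 + -iteratedDeriv 3 u (d / 2) / (3 * deriv u (d / 2))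
                  * (d / 2 - 2 * d) ^ 2))|
          ≤ C * d ^ 4 := by
  have hD1 : ContDiffAt ℝ 4 (deriv u) 0 := hu.derivWithin (by norm_num)
  have hD3 : ContDiffAt ℝ 2 (iteratedDeriv 3 u) 0 := by
    rw [iteratedDeriv_succ, iteratedDeriv_succ, iteratedDeriv_one]
    exact (hD1.derivWithin (m := 3) (by norm_num)).derivWithin (by norm_num)
  obtain ⟨M, hM, r, hr, hT⟩ := ContDiffAt.exists_taylor_remainder_right (n := 3)
    (hu.of_le (by norm_num))
  obtain ⟨M₁, hM₁, r₁, hr₁, hT₁⟩ := ContDiffAt.exists_taylor_remainder_right (n := 0)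
    (hD1.of_le (by norm_num))
  obtain ⟨M₃, hM₃, r₃, hr₃, hT₃⟩ := ContDiffAt.exists_taylor_remainder_right (n := 0)
    (hD3.of_le (by norm_num))
  simp only [Finset.sum_range_succ, Finset.range_zero, Finset.sum_empty, iteratedDeriv_zero,
    iteratedDeriv_one, Nat.factorial, zero_add, pow_zero, mul_one, Nat.cast_one, div_one,
    pow_one, Nat.reduceAdd, Nat.reduceMul, Nat.succ_eq_add_one, Nat.cast_ofNat]
    at hT hT₁ hT₃
  have hc₁ : 0 < |deriv u 0| := abs_pos.2 hu1
  set S : ℝ := (|iteratedDeriv 3 u 0| + M₃) / (3 * (|deriv u 0| / 2)) with hS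
  have hS0 : 0 < S := by positivity
  refine ⟨|u 0| * (S * (S * 100)) + |deriv u 0| * (S * (S * 150))
      + |iteratedDeriv 2 u 0 / 2| * (S * 103) + |iteratedDeriv 3 u 0 / 6| * (S * 304)
      + 10 * (16 * M) + (3 * (S * M₁) + M₃) / 16, by positivity,
    min 1 (min (r / 2) (min r₁ (min r₃ (min (|deriv u 0| / (2 * M₁)) (1 / (100 * S)))))),
    by positivity, fun d hd hdlt l1 l2 l3 h => ?_⟩
  simp only [lt_min_iff] at hdlt
  obtain ⟨hd1, hdr, hdr₁, hdr₃, hdM, hdS⟩ := hdlt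
  rw [lt_div_iff₀ (by positivity)] at hdM hdS
  have hd4 : 0 < M * d ^ 4 := by positivity
  have hv₁ : |deriv u (d / 2) - deriv u 0| ≤ M₁ * d :=
    (hT₁ (d / 2) ⟨by linarith, by linarith⟩).trans (by nlinarith)
  have hv₃ : |iteratedDeriv 3 u (d / 2) - iteratedDeriv 3 u 0| ≤ M₃ * d :=
    (hT₃ (d / 2) ⟨by linarith, by linarith⟩).trans (by nlinarith)
  have hlow : |deriv u 0| / 2 ≤ |deriv u (d / 2)| := by
    have := abs_sub_abs_le_abs_sub (deriv u 0) (deriv u (d / 2))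
    rw [abs_sub_comm] at this
    linarith
  have hup : |iteratedDeriv 3 u (d / 2)| ≤ |iteratedDeriv 3 u 0| + M₃ := by
    have := abs_sub_abs_le_abs_sub (iteratedDeriv 3 u (d / 2)) (iteratedDeriv 3 u 0)
    nlinarith
  have hne : deriv u (d / 2) ≠ 0 := abs_pos.1 (by linarith)
  have hs : |-iteratedDeriv 3 u (d / 2) / (3 * deriv u (d / 2))| ≤ S := by
    rw [abs_div, abs_neg, abs_mul, abs_of_pos (three_pos : (0 : ℝ) < 3)]
    exact div_le_div₀ (by positivity) hup (by positivity) (by linarith)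
  have hadapt : 3 * (-iteratedDeriv 3 u (d / 2) / (3 * deriv u (d / 2))) * deriv u (d / 2)
      + iteratedDeriv 3 u (d / 2) = 0 := by
    field_simp
    ring
  generalize -iteratedDeriv 3 u (d / 2) / (3 * deriv u (d / 2)) = s at *
  have hσ : |s * d ^ 2| ≤ 1 / 100 := by
    rw [abs_mul, abs_of_pos (by positivity : 0 < d ^ 2)]
    nlinarith [mul_le_mul_of_nonneg_right hs (sq_nonneg d), mul_pos hS0 hd]
  obtain ⟨p', q', m, hp', hq', hm, hw⟩ := exists_multiquadric_weights hσ
  have e0 := h 0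
  have e1 := h 1
  have e2 := h 2
  have t₀ : ∀ t : ℝ, t = 0 → Real.sqrt (1 + s * t ^ 2) = 1 := by rintro t rfl; simp
  have t₁ : ∀ t : ℝ, t ^ 2 = d ^ 2 →
      Real.sqrt (1 + s * t ^ 2) = Real.sqrt (1 + s * d ^ 2) := fun t ht => by rw [ht]
  have t₂ : ∀ t : ℝ, t ^ 2 = 4 * d ^ 2 →
      Real.sqrt (1 + s * t ^ 2) = Real.sqrt (1 + 4 * (s * d ^ 2)) := fun t ht => by
    rw [ht]; congr 1; ring
  have t₃ : ∀ t : ℝ, t ^ 2 = d ^ 2 / 4 →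
      Real.sqrt (1 + s * t ^ 2) = Real.sqrt (1 + s * d ^ 2 / 4) := fun t ht => by
    rw [ht]; congr 1; ring
  have t₄ : ∀ t : ℝ, t ^ 2 = 9 * d ^ 2 / 4 →
      Real.sqrt (1 + s * t ^ 2) = Real.sqrt (1 + 9 * (s * d ^ 2) / 4) := fun t ht => by
    rw [ht]; congr 1; ring
  simp only [Fin.val_zero, Fin.val_one, Fin.val_two, Nat.cast_zero, Nat.cast_one,
    Nat.cast_ofNat] at e0 e1 e2
  rw [t₀ (0 * d - 0 * d) (by ring), t₁ (0 * d - 1 * d) (by ring), t₂ (0 * d - 2 * d) (by ring),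
    mul_one, zero_mul] at e0
  rw [t₁ (1 * d - 0 * d) (by ring), t₀ (1 * d - 1 * d) (by ring), t₁ (1 * d - 2 * d) (by ring),
    mul_one, one_mul] at e1
  rw [t₂ (2 * d - 0 * d) (by ring), t₁ (2 * d - 1 * d) (by ring), t₀ (2 * d - 2 * d) (by ring),
    mul_one] at e2
  rw [t₃ (d / 2 - 0 * d) (by ring), t₃ (d / 2 - 1 * d) (by ring), t₄ (d / 2 - 2 * d) (by ring),
    hw _ _ _ l1 l2 l3 e0 e1 e2]
  refine abs_sub_weighted_sum_le hd hd1.le hs hσ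
    ((hT (d / 2) ⟨by linarith, by linarith⟩).trans (by nlinarith))
    ((hT d ⟨hd.le, by linarith⟩).trans (by nlinarith))
    ((hT (2 * d) ⟨by linarith, by linarith⟩).trans (by nlinarith)) hv₁ ?_ hadapt hp' hq' hm
  rwa [mul_div_cancel₀ _ (by norm_num : (6 : ℝ) ≠ 0)]
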